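/- Let X be a topological space with sobrification S and sobrification map ξ : X → S, ξ(x) = closure({x}), and let R(X) be the class of subsets R ⊆ X such that R is 0-closed and ξ(R) is compact saturated in S. If (R_j)_{j ∈ J} is a nonempty filtered family of elements of R(X) (filtered means: for all i, j ∈ J there exists k ∈ J with R_k ⊆ R_i ∩ R_j), then ⋂_{j ∈ J} R_j ∈ R(X). -/

import Mathlib

open TopologicalSpace Set

/-- The sobrification of a topological space `X`: the set of irreducible closed
subsets of `X`. -/
def Sobrification (X : Type*) [TopologicalSpace X] : Type _ :=
  {C : Set X // IsIrreducible C ∧ IsClosed C}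

/-- For an open set `U ⊆ X`, the set `Û = {C ∈ S : C ∩ U ≠ ∅}`. -/
def hatSet {X : Type*} [TopologicalSpace X] (U : Set X) : Set (Sobrification X) :=
  {C | (C.1 ∩ U).Nonempty}

/-- The topology on the sobrification, whose open sets are the sets `Û` for `U` open. -/
instance {X : Type*} [TopologicalSpace X] : TopologicalSpace (Sobrification X) :=
  TopologicalSpace.generateFrom {s | ∃ U : Set X, IsOpen U ∧ s = hatSet U}

/-- The sobrification map `ξ : X → S`, sending `x` to the closure of `{x}`. -/
def sobrMap {X : Type*} [TopologicalSpace X] (x : X) : Sobrification X :=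
  ⟨closure {x}, isIrreducible_singleton.closure, isClosed_closure⟩

/-- A subset of a topological space is saturated if it is an intersection of open sets. -/
def IsSaturatedSet {X : Type*} [TopologicalSpace X] (A : Set X) : Prop :=
  ∃ 𝒰 : Set (Set X), (∀ U ∈ 𝒰, IsOpen U) ∧ A = ⋂₀ 𝒰

/-- A subset `A` of `X` is `0`-closed if whenever `x ∈ A` and `y` has the same
closure as `x`, then `y ∈ A`. -/
def IsZeroClosed {X : Type*} [TopologicalSpace X] (A : Set X) : Prop :=
  ∀ x ∈ A, ∀ y : X, closure {y} = closure ({x} : Set X) → y ∈ A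

/-- The class `R(X)` of `0`-closed subsets whose image under the sobrification map
is compact saturated in the sobrification. -/
def RClass (X : Type*) [TopologicalSpace X] : Set (Set X) :=
  {R | IsZeroClosed R ∧ IsCompact (sobrMap '' R) ∧ IsSaturatedSet (sobrMap '' R)}

/-- For a closed set `F ⊆ X`, the set `τ(F) = {C ∈ S : C ⊆ F}`. -/
def tauSet {X : Type*} [TopologicalSpace X] (F : Set X) : Set (Sobrification X) :=
  {C | C.1 ⊆ F}

theorem isTopologicalBasis_hatSet (X : Type*) [TopologicalSpace X] :
    IsTopologicalBasis {s : Set (Sobrification X) | ∃ U : Set X, IsOpen U ∧ s = hatSet U} where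
  exists_subset_inter := by
    rintro _ ⟨U, hU, rfl⟩ _ ⟨V, hV, rfl⟩ C ⟨hCU, hCV⟩
    refine ⟨hatSet (U ∩ V), ⟨_, hU.inter hV, rfl⟩, C.2.1.2 U V hU hV hCU hCV, ?_⟩
    rintro D ⟨x, hxD, hxU, hxV⟩
    exact ⟨⟨x, hxD, hxU⟩, ⟨x, hxD, hxV⟩⟩
  sUnion_eq := eq_univ_of_forall fun C ↦
    ⟨hatSet univ, ⟨univ, isOpen_univ, rfl⟩, by simpa [hatSet] using C.2.1.1⟩
  eq_generateFrom := rfl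

theorem isOpen_hatSet {X : Type*} [TopologicalSpace X] {U : Set X} (hU : IsOpen U) :
    IsOpen (hatSet U) :=
  (isTopologicalBasis_hatSet X).isOpen ⟨U, hU, rfl⟩

instance Sobrification.quasiSober (X : Type*) [TopologicalSpace X] :
    QuasiSober (Sobrification X) where
  sober := by
    intro F hF hFc
    have meets {U : Set X} (hU : IsOpen U) :
        (closure (⋃ C ∈ F, C.1) ∩ U).Nonempty ↔ (F ∩ hatSet U).Nonempty := by
      rw [closure_inter_open_nonempty_iff hU]
      simp only [Set.Nonempty, hatSet, mem_inter_iff, mem_iUnion, mem_ofPred_eq]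
      grind
    have hirr : IsIrreducible (closure (⋃ C ∈ F, C.1)) := by
      constructor
      · obtain ⟨C, hC⟩ := hF.1
        obtain ⟨x, hx⟩ := C.2.1.1
        exact ⟨x, subset_closure (mem_biUnion hC hx)⟩
      · intro U V hU hV hAU hAV
        obtain ⟨C, hCF, hCU, hCV⟩ := hF.2 _ _ (isOpen_hatSet hU) (isOpen_hatSet hV)
          ((meets hU).1 hAU) ((meets hV).1 hAV)
        exact (meets (hU.inter hV)).2 ⟨C, hCF, C.2.1.2 U V hU hV hCU hCV⟩
    refine ⟨⟨_, hirr, isClosed_closure⟩, Subset.antisymm ?_ ?_⟩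
    · refine closure_minimal (singleton_subset_iff.2 ?_) hFc
      refine hFc.closure_subset ((isTopologicalBasis_hatSet X).mem_closure_iff.2 ?_)
      rintro _ ⟨U, hU, rfl⟩ hAU
      rw [inter_comm]
      exact (meets hU).1 hAU
    · intro C hC
      rw [(isTopologicalBasis_hatSet X).mem_closure_iff]
      rintro _ ⟨U, hU, rfl⟩ hCU
      exact ⟨_, (meets hU).2 ⟨C, hC, hCU⟩, rfl⟩

theorem IsSaturatedSet.mem_of_specializes {X : Type*} [TopologicalSpace X] {A : Set X}
    (hA : IsSaturatedSet A) {x y : X} (h : x ⤳ y) (hy : y ∈ A) : x ∈ A := by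
  obtain ⟨𝒰, h𝒰, rfl⟩ := hA
  exact fun U hU ↦ h.mem_open (h𝒰 U hU) (hy U hU)

theorem IsSaturatedSet.iInter {X : Type*} [TopologicalSpace X] {J : Type*} {A : J → Set X}
    (hA : ∀ j, IsSaturatedSet (A j)) : IsSaturatedSet (⋂ j, A j) := by
  choose 𝒰 h𝒰 hA using hA
  refine ⟨⋃ j, 𝒰 j, fun U hU ↦ ?_, ?_⟩
  · obtain ⟨j, hj⟩ := mem_iUnion.1 hU
    exact h𝒰 j U hj
  · rw [sInter_iUnion]
    exact iInter_congr hA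

/-- Quasi-sober spaces are well-filtered. -/
theorem QuasiSober.exists_subset_of_iInter_subset {Y : Type*} [TopologicalSpace Y] [QuasiSober Y]
    {J : Type*} [Nonempty J] {K : J → Set Y} (hdir : Directed (· ⊇ ·) K)
    (hK : ∀ j, IsCompact (K j)) (hsat : ∀ j, IsSaturatedSet (K j))
    {W : Set Y} (hW : IsOpen W) (hKW : ⋂ j, K j ⊆ W) : ∃ j, K j ⊆ W := by
  by_contra! hnot
  obtain ⟨F, ⟨hFc, hFW, hFK⟩, hmin⟩ :=
    zorn_superset {F : Set Y | IsClosed F ∧ F ⊆ Wᶜ ∧ ∀ j, (K j ∩ F).Nonempty} (by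
      intro c hc hchain
      rcases c.eq_empty_or_nonempty with rfl | hne
      · exact ⟨Wᶜ, ⟨hW.isClosed_compl, Subset.rfl,
          fun j ↦ inter_compl_nonempty_iff.2 (hnot j)⟩, by simp⟩
      · refine ⟨⋂₀ c, ⟨isClosed_sInter fun F hF ↦ (hc hF).1, ?_, fun j ↦ ?_⟩,
          fun F hF ↦ sInter_subset_of_mem hF⟩
        · obtain ⟨F, hF⟩ := hne
          exact (sInter_subset_of_mem hF).trans (hc hF).2.1
        · by_contra hempty
          have : Nonempty c := hne.to_subtype
          rw [not_nonempty_iff_eq_empty, sInter_eq_iInter] at hempty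
          have hdirc : Directed (· ⊇ ·) fun F : c ↦ F.1 := fun A B ↦
            (hchain.total A.2 B.2).elim (fun h ↦ ⟨A, Subset.rfl, h⟩) fun h ↦ ⟨B, h, Subset.rfl⟩
          obtain ⟨F, hF⟩ := (hK j).elim_directed_family_closed
            (fun F : c ↦ F.1) (fun F ↦ (hc F.2).1) hempty hdirc
          exact ((hc F.2).2.2 j).ne_empty hF)
  have misses {U : Set Y} (hU : IsOpen U) (hFU : (F ∩ U).Nonempty) :
      ∃ j, K j ∩ F ⊆ U := by
    by_contra! h
    have hsub : F ⊆ F ∩ Uᶜ := hmin ⟨hFc.inter hU.isClosed_compl, inter_subset_left.trans hFW,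
      fun j ↦ by simpa only [inter_assoc] using inter_compl_nonempty_iff.2 (h j)⟩ inter_subset_left
    obtain ⟨x, hxF, hxU⟩ := hFU
    exact (hsub hxF).2 hxU
  have hirr : IsIrreducible F := by
    refine ⟨(hFK (Classical.arbitrary J)).mono inter_subset_right, fun U V hU hV hFU hFV ↦ ?_⟩
    obtain ⟨i, hi⟩ := misses hU hFU
    obtain ⟨j, hj⟩ := misses hV hFV
    obtain ⟨k, hki, hkj⟩ := hdir i j
    obtain ⟨x, hxK, hxF⟩ := hFK k
    exact ⟨x, hxF, hi ⟨hki hxK, hxF⟩, hj ⟨hkj hxK, hxF⟩⟩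
  obtain ⟨p, hp⟩ := QuasiSober.sober hirr hFc
  refine hFW hp.mem (hKW (mem_iInter.2 fun j ↦ ?_))
  obtain ⟨q, hqK, hqF⟩ := hFK j
  exact (hsat j).mem_of_specializes (hp.specializes hqF) hqK

theorem IsCompact.iInter_of_directed_isSaturatedSet {Y : Type*} [TopologicalSpace Y]
    [QuasiSober Y] {J : Type*} [Nonempty J] {K : J → Set Y} (hdir : Directed (· ⊇ ·) K)
    (hK : ∀ j, IsCompact (K j)) (hsat : ∀ j, IsSaturatedSet (K j)) :
    IsCompact (⋂ j, K j) := by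
  refine isCompact_of_finite_subcover fun U hU hcov ↦ ?_
  obtain ⟨j, hj⟩ :=
    QuasiSober.exists_subset_of_iInter_subset hdir hK hsat (isOpen_iUnion hU) hcov
  obtain ⟨t, ht⟩ := (hK j).elim_finite_subcover U hU hj
  exact ⟨t, (iInter_subset K j).trans ht⟩

theorem image_sobrMap_iInter {X : Type*} [TopologicalSpace X] {J : Type*} [Nonempty J]
    {R : J → Set X} (hR : ∀ j, IsZeroClosed (R j)) :
    sobrMap '' (⋂ j, R j) = ⋂ j, sobrMap '' R j := by
  refine Subset.antisymm (image_iInter_subset R sobrMap) fun y hy ↦ ?_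
  rw [mem_iInter] at hy
  obtain ⟨x, -, rfl⟩ := hy (Classical.arbitrary J)
  refine ⟨x, mem_iInter.2 fun j ↦ ?_, rfl⟩
  obtain ⟨z, hz, hzx⟩ := hy j
  exact hR j z hz x (congrArg Subtype.val hzx).symm

/-- The intersection of a nonempty filtered family of elements of `R(X)` belongs
to `R(X)`. -/
theorem RClass_iInter (X : Type*) [TopologicalSpace X]
    {J : Type*} [Nonempty J] (R : J → Set X)
    (hfil : ∀ i j : J, ∃ k : J, R k ⊆ R i ∩ R j)
    (hR : ∀ j : J, R j ∈ RClass X) :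
    ⋂ j, R j ∈ RClass X := by
  have hdir : Directed (· ⊇ ·) fun j ↦ sobrMap '' R j := fun i j ↦ by
    obtain ⟨k, hk⟩ := hfil i j
    exact ⟨k, image_mono (hk.trans inter_subset_left), image_mono (hk.trans inter_subset_right)⟩
  refine ⟨fun x hx y hxy ↦ mem_iInter.2 fun j ↦ (hR j).1 x (mem_iInter.1 hx j) y hxy, ?_⟩
  rw [image_sobrMap_iInter fun j ↦ (hR j).1]
  exact ⟨IsCompact.iInter_of_directed_isSaturatedSet hdir (fun j ↦ (hR j).2.1)
    fun j ↦ (hR j).2.2, IsSaturatedSet.iInter fun j ↦ (hR j).2.2⟩
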